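/- For every k ≥ 1, the ADMM iterates satisfy ‖γ^{k+1} − γ^k‖ ≤ 2λ‖A⁻¹‖·‖A(c^{k+1} − c^k)‖, and consequently L_ρ(α^{k+1}, c^{k+1}, γ^k) − L_ρ(α^{k+1}, c^{k+1}, γ^{k+1}) = −(1/ρ)‖γ^{k+1} − γ^k‖² ≥ −(4λ²‖A⁻¹‖²/ρ)·‖A(c^{k+1} − c^k)‖². -/

import Mathlib

open Matrix

/-- The Euclidean (2-)norm on `ℝ^N`. -/
noncomputable def euclNorm {N : ℕ} (v : Fin N → ℝ) : ℝ :=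
  Real.sqrt (∑ i, v i ^ 2)

/-- The operator 2-norm of an `N × N` real matrix (as an operator on Euclidean space). -/
noncomputable def opNorm2 {N : ℕ} (M : Matrix (Fin N) (Fin N) ℝ) : ℝ :=
  ‖(Matrix.toEuclideanLin M).toContinuousLinearMap‖

/-- The augmented Lagrangian
`L_ρ(α, c, γ) = F(α) + λcᵀAc + γᵀ(α − Ac) + (ρ/2)‖α − Ac‖²`. -/
noncomputable def augLag {N : ℕ} (F : (Fin N → ℝ) → ℝ) (A : Matrix (Fin N) (Fin N) ℝ)
    (lam ρ : ℝ) (a c g : Fin N → ℝ) : ℝ :=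
  F a + lam * (c ⬝ᵥ A.mulVec c) + g ⬝ᵥ (a - A.mulVec c) +
    ρ / 2 * euclNorm (a - A.mulVec c) ^ 2

lemma euclNorm_sq {N : ℕ} (v : Fin N → ℝ) : euclNorm v ^ 2 = v ⬝ᵥ v := by
  rw [euclNorm, Real.sq_sqrt (Finset.sum_nonneg fun i _ => sq_nonneg (v i))]
  simp [dotProduct, sq]

lemma euclNorm_eq_norm {N : ℕ} (v : Fin N → ℝ) : euclNorm v = ‖WithLp.toLp 2 v‖ := by
  simp [euclNorm, EuclideanSpace.norm_eq]

lemma euclNorm_nonneg {N : ℕ} (v : Fin N → ℝ) : 0 ≤ euclNorm v :=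
  Real.sqrt_nonneg _

lemma euclNorm_smul {N : ℕ} (t : ℝ) (v : Fin N → ℝ) :
    euclNorm (t • v) = |t| * euclNorm v := by
  rw [euclNorm_eq_norm, euclNorm_eq_norm, WithLp.toLp_smul, norm_smul, Real.norm_eq_abs]

lemma euclNorm_mulVec_le {N : ℕ} (M : Matrix (Fin N) (Fin N) ℝ) (v : Fin N → ℝ) :
    euclNorm (M.mulVec v) ≤ opNorm2 M * euclNorm v := by
  rw [euclNorm_eq_norm, euclNorm_eq_norm]
  exact (Matrix.toEuclideanLin M).toContinuousLinearMap.le_opNorm (WithLp.toLp 2 v)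

lemma eq_zero_of_forall_linear_add_sq_nonneg {p q : ℝ}
    (h : ∀ t : ℝ, 0 ≤ t * p + t ^ 2 * q) : p = 0 := by
  have hd : discrim q p 0 ≤ 0 := discrim_le_zero fun t => by linarith [h t]
  have hp : p ^ 2 ≤ 0 := by simpa [discrim] using hd
  exact pow_eq_zero_iff two_ne_zero |>.mp (le_antisymm hp (sq_nonneg p))

lemma augLag_add_smul {N : ℕ} (F : (Fin N → ℝ) → ℝ) {A : Matrix (Fin N) (Fin N) ℝ}
    (hA : A.IsSymm) (lam ρ : ℝ) (a c g d : Fin N → ℝ) (t : ℝ) :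
    augLag F A lam ρ a (c + t • d) g = augLag F A lam ρ a c g +
      (t * (((2 * lam) • c - (g + ρ • (a - A.mulVec c))) ⬝ᵥ A.mulVec d) +
        t ^ 2 * (lam * (d ⬝ᵥ A.mulVec d) + ρ / 2 * (A.mulVec d ⬝ᵥ A.mulVec d))) := by
  have hsymm : d ⬝ᵥ A.mulVec c = c ⬝ᵥ A.mulVec d := by
    rw [dotProduct_mulVec, ← mulVec_transpose, hA.eq, dotProduct_comm]
  have hres : a - A.mulVec (c + t • d) = (a - A.mulVec c) - t • A.mulVec d := by
    rw [mulVec_add, mulVec_smul, sub_sub]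
  rw [augLag, augLag, euclNorm_sq, euclNorm_sq, hres]
  generalize a - A.mulVec c = r
  simp only [mulVec_add, mulVec_smul, dotProduct_add, add_dotProduct, dotProduct_sub,
    sub_dotProduct, dotProduct_smul, smul_dotProduct, smul_eq_mul, hsymm,
    dotProduct_comm (A.mulVec d) r]
  ring

/-- First-order optimality of a minimizer of the augmented Lagrangian in its second argument. -/
lemma augLag_minimizer_stationary {N : ℕ} {F : (Fin N → ℝ) → ℝ}
    {A : Matrix (Fin N) (Fin N) ℝ} (hAsymm : A.IsSymm) (hA : A.PosDef) {lam ρ : ℝ}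
    {a c g : Fin N → ℝ} (hc : ∀ b, augLag F A lam ρ a c g ≤ augLag F A lam ρ a b g) :
    g + ρ • (a - A.mulVec c) = (2 * lam) • c := by
  set d := (2 * lam) • c - (g + ρ • (a - A.mulVec c)) with hd
  have hp : d ⬝ᵥ A.mulVec d = 0 := eq_zero_of_forall_linear_add_sq_nonneg fun t => by
    have h := hc (c + t • d)
    rw [augLag_add_smul F hAsymm, ← hd] at h
    exact nonneg_of_le_add_right h
  have hd0 : d = 0 := by
    by_contra hne
    have hpos := hA.dotProduct_mulVec_pos hne
    rw [star_trivial, hp] at hpos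
    exact lt_irrefl _ hpos
  exact (sub_eq_zero.mp hd0).symm

lemma augLag_sub_augLag_dual {N : ℕ} (F : (Fin N → ℝ) → ℝ) (A : Matrix (Fin N) (Fin N) ℝ)
    (lam : ℝ) {ρ : ℝ} {a c g g' : Fin N → ℝ}
    (hg : g' = g + ρ • (a - A.mulVec c)) :
    augLag F A lam ρ a c g - augLag F A lam ρ a c g' =
      -(1 / ρ) * euclNorm (g' - g) ^ 2 := by
  subst hg
  rw [add_sub_cancel_left, euclNorm_sq, augLag, augLag]
  simp only [add_dotProduct, smul_dotProduct, dotProduct_smul, smul_eq_mul]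
  field_simp
  ring

/-- **Dual-increase estimates ((4.4) and (4.5))**: for every `k ≥ 1`,
`‖γ^{k+1} − γ^k‖ ≤ 2λ‖A⁻¹‖·‖A(c^{k+1} − c^k)‖`, and consequently
`L_ρ(α^{k+1}, c^{k+1}, γ^k) − L_ρ(α^{k+1}, c^{k+1}, γ^{k+1}) = −(1/ρ)‖γ^{k+1} − γ^k‖²
≥ −(4λ²‖A⁻¹‖²/ρ)‖A(c^{k+1} − c^k)‖²`. -/
theorem admm_dual_increase_estimates
    (N : ℕ) (hN : 0 < N) (A : Matrix (Fin N) (Fin N) ℝ)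
    (hAsymm : A.IsSymm) (hA : A.PosDef)
    (lam ρ : ℝ) (hlam : 0 < lam) (hρ : 0 < ρ)
    (F : (Fin N → ℝ) → ℝ) (hF0 : ∀ v, 0 ≤ F v) (hFlsc : LowerSemicontinuous F)
    (α c γ : ℕ → Fin N → ℝ)
    (hα : ∀ k, ∀ a : Fin N → ℝ,
      augLag F A lam ρ (α (k+1)) (c k) (γ k) ≤ augLag F A lam ρ a (c k) (γ k))
    (hc : ∀ k, ∀ b : Fin N → ℝ,
      augLag F A lam ρ (α (k+1)) (c (k+1)) (γ k) ≤ augLag F A lam ρ (α (k+1)) b (γ k))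
    (hγ : ∀ k, γ (k+1) = γ k + ρ • (α (k+1) - A.mulVec (c (k+1))))
    : ∀ k : ℕ, 1 ≤ k →
      euclNorm (γ (k+1) - γ k) ≤
        2 * lam * opNorm2 A⁻¹ * euclNorm (A.mulVec (c (k+1) - c k)) ∧
      augLag F A lam ρ (α (k+1)) (c (k+1)) (γ k) -
          augLag F A lam ρ (α (k+1)) (c (k+1)) (γ (k+1)) =
        -(1 / ρ) * euclNorm (γ (k+1) - γ k) ^ 2 ∧
      -(1 / ρ) * euclNorm (γ (k+1) - γ k) ^ 2 ≥
        -(4 * lam ^ 2 * opNorm2 A⁻¹ ^ 2 / ρ) *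
          euclNorm (A.mulVec (c (k+1) - c k)) ^ 2 := by
  intro k hk
  have hdual : ∀ j, γ (j + 1) = (2 * lam) • c (j + 1) := fun j =>
    (hγ j).trans (augLag_minimizer_stationary hAsymm hA (hc j))
  have hdiff : γ (k + 1) - γ k = (2 * lam) • (c (k + 1) - c k) := by
    obtain ⟨j, rfl⟩ := Nat.exists_eq_add_of_le' hk
    rw [hdual, hdual, smul_sub]
  have hinv : A⁻¹.mulVec (A.mulVec (c (k + 1) - c k)) = c (k + 1) - c k := by
    rw [mulVec_mulVec, nonsing_inv_mul A ((isUnit_iff_isUnit_det A).mp hA.isUnit), one_mulVec]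
  have hle : euclNorm (γ (k + 1) - γ k) ≤
      2 * lam * opNorm2 A⁻¹ * euclNorm (A.mulVec (c (k + 1) - c k)) := by
    have h := euclNorm_mulVec_le A⁻¹ (A.mulVec (c (k + 1) - c k))
    rw [hinv] at h
    rw [hdiff, euclNorm_smul, abs_of_pos (by positivity), mul_assoc (2 * lam)]
    gcongr
  refine ⟨hle, augLag_sub_augLag_dual F A lam (hγ k), ?_⟩
  have hsq := pow_le_pow_left₀ (euclNorm_nonneg _) hle 2
  have hdiv := mul_le_mul_of_nonneg_left hsq (one_div_pos.mpr hρ).le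
  have hrw : -(4 * lam ^ 2 * opNorm2 A⁻¹ ^ 2 / ρ) *
      euclNorm (A.mulVec (c (k + 1) - c k)) ^ 2 =
      -(1 / ρ * (2 * lam * opNorm2 A⁻¹ * euclNorm (A.mulVec (c (k + 1) - c k))) ^ 2) := by
    ring
  rw [hrw]
  linarith
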